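/- There exists a universal constant c > 0 such that the following holds. Let Σ ∈ ℝ^{d×d} be symmetric positive definite and let S ⊆ ℝ^d be measurable with N(0,Σ;S) ≥ β for some β ∈ (0,1]. Then for every symmetric U ∈ ℝ^{d×d} and every v ∈ ℝ^d, Var_{z ∼ N(0,Σ,S)}[−(1/2) zᵀUz + vᵀz] ≥ c · β⁴ · λ_m(Σ) · (‖U‖_F² + ‖v‖₂²); equivalently, the covariance matrix of the statistic t(z) = ((−(1/2)zzᵀ)^♭, z) under the truncated normal N(0,Σ,S), viewed as a quadratic form on pairs (U,v) with U symmetric, is bounded below by c β⁴ λ_m(Σ) times the identity. -/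

import Mathlib

open MeasureTheory ProbabilityTheory Matrix Real

noncomputable section

/-- Euclidean norm of a vector in `ℝ^d`. -/
def vnorm {d : ℕ} (x : Fin d → ℝ) : ℝ := Real.sqrt (∑ i, x i ^ 2)

/-- Frobenius norm of a `d × d` real matrix. -/
def fnorm {d : ℕ} (A : Matrix (Fin d) (Fin d) ℝ) : ℝ := Real.sqrt (∑ i, ∑ j, A i j ^ 2)

/-- Density of the `d`-variate normal distribution `N(μ, Σ)`. -/
def gpdf {d : ℕ} (μ : Fin d → ℝ) (Sg : Matrix (Fin d) (Fin d) ℝ) (x : Fin d → ℝ) : ℝ :=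
  (Real.sqrt ((2 * Real.pi) ^ d * Sg.det))⁻¹ *
    Real.exp (-(1 / 2) * ((x - μ) ⬝ᵥ (Sg⁻¹ *ᵥ (x - μ))))

/-- The `d`-variate normal distribution `N(μ, Σ)` as a measure on `ℝ^d`. -/
def gauss {d : ℕ} (μ : Fin d → ℝ) (Sg : Matrix (Fin d) (Fin d) ℝ) : Measure (Fin d → ℝ) :=
  volume.withDensity fun x => ENNReal.ofReal (gpdf μ Sg x)

/-- The `S`-truncated normal distribution `N(μ, Σ, S)`: the normal `N(μ, Σ)`
conditioned on taking values in `S`. -/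
def truncGauss {d : ℕ} (μ : Fin d → ℝ) (Sg : Matrix (Fin d) (Fin d) ℝ)
    (S : Set (Fin d → ℝ)) : Measure (Fin d → ℝ) :=
  ProbabilityTheory.cond (gauss μ Sg) S

/-- Mean vector of a measure on `ℝ^d`. -/
def meanv {d : ℕ} (P : Measure (Fin d → ℝ)) : Fin d → ℝ := fun i => ∫ x, x i ∂P

/-- Covariance matrix of a measure on `ℝ^d`. -/
def covm {d : ℕ} (P : Measure (Fin d → ℝ)) : Matrix (Fin d) (Fin d) ℝ :=
  Matrix.of fun i j => ∫ x, (x i - meanv P i) * (x j - meanv P j) ∂P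

/-- The minimum eigenvalue `λ_m(Σ) = min{ min_{i,j} λ_i λ_j , min_i λ_i }` of the fourth
moment tensor of `N(0,Σ)`, where `λ₁,…,λ_d` are the eigenvalues of the Hermitian matrix `Σ`. -/
def lambdaM {d : ℕ} (Sg : Matrix (Fin d) (Fin d) ℝ) (hSg : Sg.IsHermitian) : ℝ :=
  min (⨅ p : Fin d × Fin d, hSg.eigenvalues p.1 * hSg.eigenvalues p.2)
    (⨅ i, hSg.eigenvalues i)

abbrev gam : Measure ℝ := gaussianReal 0 1

lemma phi1 (a b : ℝ) :
    ‖∫ x, Complex.exp (Complex.I * ((a * x ^ 2 + b * x : ℝ) : ℂ)) ∂gam‖ ^ 4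
      ≤ (1 + 2 * (2 * a ^ 2 + b ^ 2))⁻¹ := by
  set B : ℂ := -(1/2) + Complex.I * a with hB
  have hBre : B.re < 0 := by simp [hB]
  have hBn : Complex.normSq B = 1/4 + a^2 := by
    simp [hB, Complex.normSq_apply]; ring
  have h1 : ∫ x, Complex.exp (Complex.I * ((a * x ^ 2 + b * x : ℝ) : ℂ)) ∂gam
      = ((√(2 * π))⁻¹ : ℝ) * ((π / -B) ^ (1/2 : ℂ) * Complex.exp (0 - (Complex.I * b) ^ 2 / (4 * B))) := by
    rw [← integral_cexp_quadratic hBre, integral_gaussianReal_eq_integral_smul one_ne_zero,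
      ← integral_const_mul]
    congr 1
    ext x
    rw [gaussianPDFReal, Complex.real_smul]
    push_cast
    rw [mul_assoc, ← Complex.exp_add]
    simp only [NNReal.coe_one, mul_one, Complex.ofReal_one]
    congr 2
    rw [hB]; ring
  rw [h1, norm_mul, norm_mul, mul_pow, mul_pow]
  have h2 : ‖((√(2 * π))⁻¹ : ℝ) + (0:ℂ)‖ ^ 4 = (4 * π ^ 2)⁻¹ := by
    rw [add_zero, Complex.norm_real, Real.norm_eq_abs, abs_of_nonneg (by positivity), inv_pow]
    congr 1
    have : √(2*π) ^ 4 = (√(2*π) ^ 2)^2 := by ring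
    rw [this, Real.sq_sqrt (by positivity)]; ring
  rw [add_zero] at h2
  have h3 : ‖((π : ℂ) / -B) ^ (1/2 : ℂ)‖ ^ 4 = π ^ 2 / (1/4 + a^2) := by
    have e : ‖((π : ℂ) / -B) ^ (1/2 : ℂ)‖ ^ 4 = ‖(((π : ℂ) / -B) ^ (1/2 : ℂ)) ^ 2‖ ^ 2 := by
      rw [norm_pow]; ring
    have e2 : (((π : ℂ) / -B) ^ (1/2 : ℂ)) ^ 2 = (π : ℂ) / -B := by
      have := Complex.cpow_nat_inv_pow ((π : ℂ) / -B) (n := 2) (by norm_num)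
      simpa using this
    rw [e, e2, norm_div, norm_neg, div_pow, ← Complex.normSq_eq_norm_sq B, hBn]
    simp
  have h4 : ‖Complex.exp (0 - (Complex.I * b) ^ 2 / (4 * B))‖ ^ 4 = Real.exp (-(2 * b^2 / (1 + 4 * a^2))) := by
    rw [Complex.norm_exp, ← Real.exp_nat_mul]
    congr 1
    have : (0 - (Complex.I * b) ^ 2 / (4 * B)) = ((b^2/4 : ℝ) : ℂ) * B⁻¹ := by
      rw [mul_pow, Complex.I_sq]; push_cast
      rw [div_eq_mul_inv, mul_inv]; ring
    rw [this, Complex.re_ofReal_mul, Complex.inv_re, hBn]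
    have : B.re = -(1/2) := by simp [hB]
    rw [this]
    push_cast
    have : (1:ℝ)/4 + a^2 ≠ 0 := by positivity
    have : (1:ℝ) + 4 * a^2 ≠ 0 := by positivity
    field_simp
    ring
  rw [h2, h3, h4, Real.exp_neg]
  have h5 := Real.add_one_le_exp (2 * b^2 / (1 + 4 * a^2))
  have h6 : (4 * π ^ 2)⁻¹ * (π ^ 2 / (1 / 4 + a ^ 2) * (Real.exp (2 * b ^ 2 / (1 + 4 * a ^ 2)))⁻¹)
     = ((1 + 4 * a^2) * (Real.exp (2 * b ^ 2 / (1 + 4 * a ^ 2))))⁻¹ := by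
    have := Real.pi_pos
    rw [mul_inv]
    rw [← mul_assoc]
    field_simp
  rw [h6]
  apply inv_anti₀ (by positivity)
  calc 1 + 2 * (2 * a ^ 2 + b ^ 2) = (1 + 4 * a^2) * (2 * b^2 / (1 + 4 * a^2) + 1) := by
        field_simp; ring
    _ ≤ _ := by gcongr

lemma one_add_sum_le {ι : Type*} (s : Finset ι) (f : ι → ℝ) (hf : ∀ i, 0 ≤ f i) :
    1 + ∑ i ∈ s, f i ≤ ∏ i ∈ s, (1 + f i) := by
  classical
  induction s using Finset.induction_on with
  | empty => simp
  | insert i s hi ih =>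
    rw [Finset.sum_insert hi, Finset.prod_insert hi]
    have : 0 ≤ ∑ i ∈ s, f i := Finset.sum_nonneg fun i _ => hf i
    nlinarith [hf i, mul_nonneg (hf i) this, mul_le_mul_of_nonneg_left ih (hf i)]

abbrev gamn (d : ℕ) : Measure (Fin d → ℝ) := Measure.pi fun _ => gam

def quad {d : ℕ} (a b : Fin d → ℝ) (y : Fin d → ℝ) : ℝ := ∑ i, (a i * y i ^ 2 + b i * y i)
def qvar {d : ℕ} (a b : Fin d → ℝ) : ℝ := ∑ i, (2 * a i ^ 2 + b i ^ 2)

lemma phin {d : ℕ} (a b : Fin d → ℝ) (t : ℝ) :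
    ‖∫ y, Complex.exp (Complex.I * ((t * quad a b y : ℝ) : ℂ)) ∂(gamn d)‖ ^ 4
      ≤ (1 + 2 * t ^ 2 * qvar a b)⁻¹ := by
  have h1 : ∫ y, Complex.exp (Complex.I * ((t * quad a b y : ℝ) : ℂ)) ∂(gamn d)
     = ∏ i, ∫ x, Complex.exp (Complex.I * (((t * a i) * x ^ 2 + (t * b i) * x : ℝ) : ℂ)) ∂gam := by
    rw [← integral_fintype_prod_eq_prod (𝕜 := ℂ)
      (f := fun i x => Complex.exp (Complex.I * (((t * a i) * x ^ 2 + (t * b i) * x : ℝ) : ℂ)))]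
    congr 1
    ext y
    rw [← Complex.exp_sum, ← Finset.mul_sum, ← Complex.ofReal_sum, quad, Finset.mul_sum]
    congr 4
    ext i
    ring
  rw [h1, norm_prod, ← Finset.prod_pow]
  calc _ ≤ ∏ i, (1 + 2 * (2 * (t * a i) ^ 2 + (t * b i) ^ 2))⁻¹ :=
        Finset.prod_le_prod (fun i _ => by positivity) (fun i _ => phi1 _ _)
    _ = (∏ i, (1 + 2 * (2 * (t * a i) ^ 2 + (t * b i) ^ 2)))⁻¹ := by rw [Finset.prod_inv_distrib]
    _ ≤ _ := by
      apply inv_anti₀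
      · have : 0 ≤ qvar a b := Finset.sum_nonneg fun i _ => by positivity
        positivity
      · refine le_trans (le_of_eq ?_) (one_add_sum_le _ _ (fun i => by positivity))
        rw [qvar, Finset.mul_sum]
        congr 2
        ext i; ring

/-- The constant `E |g|^{-1/2}` is finite. -/
lemma int_half : Integrable (fun t : ℝ => |t| ^ (-(1/2) : ℝ)) gam := by
  have h0 : gam = volume.withDensity (gaussianPDF 0 1) := gaussianReal_of_var_ne_zero 0 one_ne_zero
  rw [h0, integrable_withDensity_iff_integrable_smul' (measurable_gaussianPDF _ _)
      (ae_of_all _ fun _ ↦ gaussianPDF_lt_top)]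
  have h := integrable_rpow_mul_exp_neg_mul_sq (b := 1/2) (by norm_num) (s := -(1/2)) (by norm_num)
  have h' := h.comp_neg
  refine ((h.add h').const_mul (√(2 * π))⁻¹).congr (ae_of_all _ fun x => ?_)
  simp only [Pi.add_apply, toReal_gaussianPDF, gaussianPDFReal, smul_eq_mul, NNReal.coe_one, mul_one, sub_zero]
  have hneg : ∀ z : ℝ, z < 0 → z ^ (-(1/2) : ℝ) = 0 := by
    intro z hz
    rw [Real.rpow_def_of_neg hz, show -(1/2) * π = -(π/2) by ring, Real.cos_neg, Real.cos_pi_div_two, mul_zero]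
  have : |x| ^ (-(1/2) : ℝ) = x ^ (-(1/2) : ℝ) + (-x) ^ (-(1/2) : ℝ) := by
    rcases lt_trichotomy x 0 with hx | hx | hx
    · rw [abs_of_neg hx, hneg x hx, zero_add]
    · subst hx; simp [Real.zero_rpow]
    · rw [abs_of_pos hx, hneg (-x) (by linarith), add_zero]
  rw [this]
  have e : -x^2/2 = -(1/2) * x^2 := by ring
  rw [e, neg_sq]
  ring

def K0 : ℝ := ∫ t : ℝ, |t| ^ (-(1/2) : ℝ) ∂gam

lemma K0_nonneg : 0 ≤ K0 := integral_nonneg fun t => by positivity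

lemma quad_cont {d : ℕ} (a b : Fin d → ℝ) : Continuous (quad a b) := by
  unfold quad; fun_prop

lemma smallball1 {d : ℕ} (a b : Fin d → ℝ) (hσ : 0 < qvar a b) (m : ℝ) :
    (gamn d).real {y | |quad a b y - m| < 1} ≤ Real.exp (1/2) * K0 * (qvar a b) ^ (-(1/4) : ℝ) := by
  have hchar : ∀ x : ℝ, ∫ t, Complex.exp (Complex.I * ((t * x : ℝ) : ℂ)) ∂gam = (Real.exp (-(x^2/2)) : ℂ) := by
    intro x
    have := charFun_gaussianReal (μ := 0) (v := 1) x
    rw [charFun_apply_real] at this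
    simp only [NNReal.coe_one, Complex.ofReal_zero, mul_zero, zero_mul, Complex.ofReal_one, one_mul, zero_sub] at this
    push_cast
    rw [← this]
    congr 1; ext t; congr 1; ring
  set q := qvar a b with hq
  have hmeasS : MeasurableSet {y | |quad a b y - m| < 1} := by
    apply measurableSet_lt _ measurable_const
    exact ((quad_cont a b).sub continuous_const).abs.measurable
  have hcontg : Continuous fun y => Real.exp (-((quad a b y - m)^2/2)) := by
    have := quad_cont a b
    fun_prop
  have hintg : Integrable (fun y => Real.exp (-((quad a b y - m)^2/2))) (gamn d) := by
    apply Integrable.of_bound hcontg.aestronglyMeasurable 1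
    refine ae_of_all _ fun y => ?_
    rw [Real.norm_eq_abs, abs_of_pos (Real.exp_pos _), Real.exp_le_one_iff]
    have := sq_nonneg (quad a b y - m); linarith
  have s1 : (gamn d).real {y | |quad a b y - m| < 1} ≤
      Real.exp (1/2) * ∫ y, Real.exp (-((quad a b y - m)^2/2)) ∂(gamn d) := by
    rw [← integral_indicator_one hmeasS, ← integral_const_mul]
    apply integral_mono_of_nonneg
    · exact ae_of_all _ fun y => Set.indicator_nonneg (fun _ _ => zero_le_one) _
    · exact hintg.const_mul _
    · refine ae_of_all _ fun y => ?_
      dsimp only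
      by_cases hy : y ∈ {y | |quad a b y - m| < 1}
      · rw [Set.indicator_of_mem hy, ← Real.exp_add, Pi.one_apply]
        apply Real.one_le_exp
        have : |quad a b y - m| < 1 := hy
        have := (sq_lt_one_iff_abs_lt_one _).2 this
        linarith
      · rw [Set.indicator_of_notMem hy]; positivity
  refine s1.trans ?_
  rw [mul_assoc]
  gcongr
  have hswap : ((∫ y, Real.exp (-((quad a b y - m)^2/2)) ∂(gamn d) : ℝ) : ℂ)
      = ∫ t, (∫ y, Complex.exp (Complex.I * ((t * (quad a b y - m) : ℝ) : ℂ)) ∂(gamn d)) ∂gam := by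
    rw [← integral_complex_ofReal]
    simp_rw [← hchar]
    rw [integral_integral_swap]
    have hc : Continuous (Function.uncurry fun (y : Fin d → ℝ) (t : ℝ) =>
        Complex.exp (Complex.I * ((t * (quad a b y - m) : ℝ) : ℂ))) := by
      have := quad_cont a b
      unfold Function.uncurry
      fun_prop
    apply Integrable.of_bound hc.aestronglyMeasurable 1
    refine ae_of_all _ fun p => ?_
    simp only [Function.uncurry]
    rw [mul_comm, Complex.norm_exp_ofReal_mul_I]
  have hin : ∀ t : ℝ, ‖∫ y, Complex.exp (Complex.I * ((t * (quad a b y - m) : ℝ) : ℂ)) ∂(gamn d)‖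
      = ‖∫ y, Complex.exp (Complex.I * ((t * quad a b y : ℝ) : ℂ)) ∂(gamn d)‖ := by
    intro t
    have : ∀ y, Complex.exp (Complex.I * ((t * (quad a b y - m) : ℝ) : ℂ))
        = Complex.exp (((-(t*m) : ℝ) : ℂ) * Complex.I) * Complex.exp (Complex.I * ((t * quad a b y : ℝ) : ℂ)) := by
      intro y
      rw [← Complex.exp_add]; congr 1; push_cast; ring
    simp_rw [this]
    rw [integral_const_mul, norm_mul, Complex.norm_exp_ofReal_mul_I, one_mul]
  calc ∫ y, Real.exp (-((quad a b y - m)^2/2)) ∂(gamn d)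
      = ‖((∫ y, Real.exp (-((quad a b y - m)^2/2)) ∂(gamn d) : ℝ) : ℂ)‖ := by
        rw [Complex.norm_real, Real.norm_eq_abs, abs_of_nonneg]
        exact integral_nonneg fun y => (Real.exp_pos _).le
    _ ≤ ∫ t, ‖∫ y, Complex.exp (Complex.I * ((t * (quad a b y - m) : ℝ) : ℂ)) ∂(gamn d)‖ ∂gam := by
        rw [hswap]; exact norm_integral_le_integral_norm _
    _ ≤ ∫ t, |t| ^ (-(1/2) : ℝ) * q ^ (-(1/4) : ℝ) ∂gam := by
        apply integral_mono_of_nonneg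
        · exact ae_of_all _ fun t => norm_nonneg _
        · exact int_half.mul_const _
        · have hne : ∀ᵐ t ∂gam, t ≠ 0 := by
            have := nullSingletonClass_gaussianReal (μ := 0) (v := 1) one_ne_zero
            simp [ae_iff]
          filter_upwards [hne] with t ht
          rw [hin t]
          have h4 := phin a b t
          rw [← hq] at h4
          have htp : 0 < |t| := abs_pos.2 ht
          have h5 : (|t| ^ (-(1/2) : ℝ) * q ^ (-(1/4) : ℝ)) ^ 4 = (t^2 * q)⁻¹ := by
            rw [mul_pow, ← Real.rpow_mul_natCast htp.le, ← Real.rpow_mul_natCast hσ.le]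
            norm_num
            rw [Real.rpow_neg_one, mul_comm]
          refine le_of_pow_le_pow_left₀ (n := 4) (by norm_num) (by positivity) (h4.trans ?_)
          rw [h5]
          have ht2 : 0 < t^2 := by positivity
          apply inv_anti₀ (by positivity)
          nlinarith [mul_pos ht2 hσ]
    _ = K0 * q ^ (-(1/4) : ℝ) := by rw [integral_mul_const, K0]

lemma smallball {d : ℕ} (a b : Fin d → ℝ) (hσ : 0 < qvar a b) (m ε : ℝ) (hε : 0 < ε) :
    (gamn d).real {y | |quad a b y - m| < ε}
      ≤ Real.exp (1/2) * K0 * (qvar a b / ε ^ 2) ^ (-(1/4) : ℝ) := by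
  have h1 : qvar (fun i => a i / ε) (fun i => b i / ε) = qvar a b / ε ^ 2 := by
    unfold qvar; rw [Finset.sum_div]; congr 1; ext i; field_simp
  have h2 : ∀ y, quad (fun i => a i / ε) (fun i => b i / ε) y = quad a b y / ε := by
    intro y; unfold quad; rw [Finset.sum_div]; congr 1; ext i; field_simp
  have h := smallball1 (fun i => a i / ε) (fun i => b i / ε) (by rw [h1]; positivity) (m / ε)
  rw [h1] at h
  convert h using 3
  ext y
  rw [h2, ← sub_div, abs_div, abs_of_pos hε, div_lt_one hε]

lemma gamn_eq (d : ℕ) : gamn d = volume.withDensity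
    (fun y : Fin d → ℝ => ENNReal.ofReal (∏ i, gaussianPDFReal 0 1 (y i))) := by
  apply (Measure.pi_eq ?_)
  intro s hs
  have hms : MeasurableSet (Set.univ.pi s) := MeasurableSet.univ_pi hs
  have hint : Integrable (fun y : Fin d → ℝ => ∏ i, gaussianPDFReal 0 1 (y i)) := by
    apply Integrable.fintype_prod (f := fun _ x => gaussianPDFReal 0 1 x)
    intro i; exact integrable_gaussianPDFReal 0 1
  rw [withDensity_apply _ hms, ← ofReal_integral_eq_lintegral_ofReal hint.integrableOn
    (ae_of_all _ fun y => Finset.prod_nonneg fun i _ => gaussianPDFReal_nonneg _ _ _)]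
  have : ∀ i, gam (s i) = ENNReal.ofReal (∫ x, (s i).indicator (gaussianPDFReal 0 1) x) := by
    intro i
    rw [gaussianReal_apply_eq_integral _ one_ne_zero, integral_indicator (hs i)]
  simp_rw [this]
  rw [← ENNReal.ofReal_prod_of_nonneg, ← integral_fintype_prod_volume_eq_prod (𝕜 := ℝ)
     (f := fun i x => (s i).indicator (gaussianPDFReal 0 1) x), ← integral_indicator hms]
  · congr 2
    ext y
    by_cases hy : y ∈ Set.univ.pi s
    · rw [Set.indicator_of_mem hy]
      apply Finset.prod_congr rfl
      intro i _
      rw [Set.indicator_of_mem (hy i (Set.mem_univ i))]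
    · rw [Set.indicator_of_notMem hy]
      simp only [Set.mem_pi, Set.mem_univ, true_implies, not_forall] at hy
      obtain ⟨i, hi⟩ := hy
      exact (Finset.prod_eq_zero (Finset.mem_univ i) (Set.indicator_of_notMem hi _)).symm
  · intro i _
    exact integral_nonneg fun x => Set.indicator_nonneg (fun x _ => gaussianPDFReal_nonneg _ _ _) _

lemma gauss_eq_map {d : ℕ} (L : Matrix (Fin d) (Fin d) ℝ) (hL : L.det ≠ 0) :
    gauss 0 (L * Lᵀ) = (gamn d).map (fun y => L *ᵥ y) := by
  have hLm : Measurable (fun y : Fin d → ℝ => L *ᵥ y) := by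
    have : Continuous (fun y : Fin d → ℝ => L *ᵥ y) := by fun_prop
    exact this.measurable
  have hg : Measurable fun x : Fin d → ℝ => ENNReal.ofReal (gpdf 0 (L * Lᵀ) x) := by
    apply Measurable.ennreal_ofReal
    have : Continuous (gpdf 0 (L * Lᵀ)) := by unfold gpdf; fun_prop
    exact this.measurable
  have hvol : (volume : Measure (Fin d → ℝ)) =
      ENNReal.ofReal |L.det| • Measure.map (fun y => L *ᵥ y) volume := by
    have := Real.map_matrix_volume_pi_eq_smul_volume_pi hL
    have e : (fun y : Fin d → ℝ => L *ᵥ y) = (Matrix.toLin' L : (Fin d → ℝ) → (Fin d → ℝ)) := by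
      ext y; simp
    rw [e, this, smul_smul, ← ENNReal.ofReal_mul (abs_nonneg _), abs_inv,
      mul_inv_cancel₀ (abs_ne_zero.2 hL)]
    simp
  have hpdf : ∀ y : Fin d → ℝ, |L.det| * gpdf 0 (L * Lᵀ) (L *ᵥ y) = ∏ i, gaussianPDFReal 0 1 (y i) := by
    intro y
    unfold gpdf gaussianPDFReal
    rw [Finset.prod_mul_distrib, ← Real.exp_sum, ← mul_assoc]
    congr 1
    · rw [det_mul, det_transpose, Real.sqrt_mul (by positivity), Real.sqrt_mul_self_eq_abs, mul_inv]
      simp only [NNReal.coe_one, mul_one, Finset.prod_const, Finset.card_univ, Fintype.card_fin]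
      rw [mul_comm, mul_assoc, inv_mul_cancel₀ (abs_ne_zero.2 hL), mul_one, inv_pow]
      congr 1
      rw [Real.sqrt_eq_iff_mul_self_eq (by positivity) (by positivity), ← mul_pow,
        Real.mul_self_sqrt (by positivity)]
    · congr 1
      have hu : IsUnit L.det := isUnit_iff_ne_zero.2 hL
      have hu' : IsUnit Lᵀ.det := by rwa [det_transpose]
      rw [sub_zero, Matrix.mul_inv_rev, mulVec_mulVec, mul_assoc, nonsing_inv_mul _ hu, mul_one,
        ← Matrix.vecMul_transpose, ← dotProduct_mulVec, mulVec_mulVec, mul_nonsing_inv _ hu', one_mulVec,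
        dotProduct, Finset.mul_sum]
      apply Finset.sum_congr rfl
      intro i _
      simp; ring
  ext s hs
  rw [Measure.map_apply hLm hs, gamn_eq, withDensity_apply _ (hLm hs), gauss, withDensity_apply _ hs]
  conv_lhs => rw [hvol]
  rw [Measure.restrict_smul, lintegral_smul_measure, setLIntegral_map hs hg hLm, smul_eq_mul,
    ← lintegral_const_mul (f := fun y => ENNReal.ofReal (gpdf 0 (L * Lᵀ) (L *ᵥ y))) _ (hg.comp hLm)]
  congr 1
  ext y
  rw [← ENNReal.ofReal_mul (abs_nonneg _), hpdf]

lemma memLp_quad {d : ℕ} (a b : Fin d → ℝ) : MemLp (quad a b) 2 (gamn d) := by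
  unfold quad
  apply memLp_finsetSum
  intro i _
  have h1 : MemLp (fun x : ℝ => x) 4 gam := memLp_id_gaussianReal' 4 (by simp)
  have h2 : MemLp (fun x : ℝ => x) 2 gam := memLp_id_gaussianReal' 2 (by simp)
  have h3 : MemLp (fun x : ℝ => x ^ 2) 2 gam := by
    have : ENNReal.HolderTriple 4 4 2 := ⟨by
      rw [← two_mul, show (4 : ENNReal) = 2 * 2 by norm_num, ENNReal.mul_inv (by simp) (by simp), ← mul_assoc,
        ENNReal.mul_inv_cancel (by simp) (by simp), one_mul]⟩
    have := h1.mul' h1 (r := 2)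
    simpa [sq] using this
  have h4 : MemLp (fun x : ℝ => a i * x ^ 2 + b i * x) 2 gam := (h3.const_mul _).add (h2.const_mul _)
  exact h4.comp_measurePreserving (measurePreserving_eval (fun _ => gam) i)

/-- Frobenius norm squared as a trace. -/
lemma sumsq_eq_trace {d : ℕ} (A : Matrix (Fin d) (Fin d) ℝ) :
    ∑ i, ∑ j, A i j ^ 2 = (A * Aᵀ).trace := by
  simp [trace, Matrix.mul_apply, sq]

lemma sumsq_conj {d : ℕ} (P A : Matrix (Fin d) (Fin d) ℝ) (hP : P * Pᵀ = 1) :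
    ∑ i, ∑ j, (Pᵀ * A * P) i j ^ 2 = ∑ i, ∑ j, A i j ^ 2 := by
  rw [sumsq_eq_trace, sumsq_eq_trace]
  have : Pᵀ * A * P * (Pᵀ * A * P)ᵀ = Pᵀ * (A * (P * Pᵀ) * Aᵀ * P) := by
    simp only [transpose_mul, transpose_transpose, Matrix.mul_assoc]
  rw [this, hP, Matrix.mul_one, trace_mul_comm, Matrix.mul_assoc, hP, Matrix.mul_one]

lemma sumsq_vec {d : ℕ} (P : Matrix (Fin d) (Fin d) ℝ) (hP : P * Pᵀ = 1) (v : Fin d → ℝ) :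
    ∑ i, (Pᵀ *ᵥ v) i ^ 2 = ∑ i, v i ^ 2 := by
  have h : ∀ w : Fin d → ℝ, ∑ i, w i ^ 2 = w ⬝ᵥ w := by intro w; simp [dotProduct, sq]
  rw [h, h, dotProduct_mulVec, vecMul_transpose, mulVec_mulVec, hP, one_mulVec]

lemma spectral {d : ℕ} (A : Matrix (Fin d) (Fin d) ℝ) (hA : A.IsHermitian) :
    ∃ P : Matrix (Fin d) (Fin d) ℝ, P * Pᵀ = 1 ∧ Pᵀ * P = 1 ∧
      A = P * diagonal hA.eigenvalues * Pᵀ := by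
  refine ⟨hA.eigenvectorUnitary, ?_, ?_, ?_⟩
  · have := Unitary.coe_mul_star_self hA.eigenvectorUnitary
    simpa [star_eq_conjTranspose] using this
  · have := Unitary.coe_star_mul_self hA.eigenvectorUnitary
    simpa [star_eq_conjTranspose] using this
  · have := hA.spectral_theorem
    rw [Unitary.conjStarAlgAut_apply] at this
    simpa [star_eq_conjTranspose, Function.comp_def] using this

lemma reduction {d : ℕ} (Sg : Matrix (Fin d) (Fin d) ℝ) (hSg : Sg.PosDef)
    (U : Matrix (Fin d) (Fin d) ℝ) (hU : U.IsSymm) (v : Fin d → ℝ) :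
    ∃ (L : Matrix (Fin d) (Fin d) ℝ) (a b : Fin d → ℝ), L.det ≠ 0 ∧ Sg = L * Lᵀ ∧
      (∀ y, -(1 / 2) * ((L *ᵥ y) ⬝ᵥ (U *ᵥ (L *ᵥ y))) + v ⬝ᵥ (L *ᵥ y) = quad a b y) ∧
      lambdaM Sg hSg.1 * (fnorm U ^ 2 + vnorm v ^ 2) ≤ 2 * qvar a b := by
  obtain ⟨P, hP1, hP2, hPS⟩ := spectral Sg hSg.1
  set lam := hSg.1.eigenvalues with hlam
  have hpos : ∀ i, 0 < lam i := hSg.eigenvalues_pos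
  set D : Matrix (Fin d) (Fin d) ℝ := diagonal fun i => √(lam i) with hD
  have hDD : D * Dᵀ = diagonal lam := by
    rw [hD, diagonal_transpose, diagonal_mul_diagonal]
    congr 1; ext i; exact Real.mul_self_sqrt (hpos i).le
  set M := D * (Pᵀ * U * P) * D with hM
  have hMs : M.IsHermitian := by
    rw [Matrix.IsHermitian, conjTranspose_eq_transpose_of_trivial, hM]
    simp only [transpose_mul, transpose_transpose, hU.eq, hD, diagonal_transpose, Matrix.mul_assoc]
  obtain ⟨Q, hQ1, hQ2, hQM⟩ := spectral M hMs
  set ev := hMs.eigenvalues with hev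
  have hQM' : Qᵀ * M * Q = diagonal ev := by
    conv_lhs => rw [hQM]
    calc Qᵀ * (Q * diagonal ev * Qᵀ) * Q = (Qᵀ * Q) * diagonal ev * (Qᵀ * Q) := by
          simp only [Matrix.mul_assoc]
      _ = _ := by rw [hQ2, Matrix.one_mul, Matrix.mul_one]
  set L := P * D * Q with hL
  have hLU : Lᵀ * U * L = diagonal ev := by
    rw [← hQM', hL, hM]
    simp only [transpose_mul, hD, diagonal_transpose, Matrix.mul_assoc]
  have hLL : Sg = L * Lᵀ := by
    rw [hPS, hL]
    calc P * diagonal lam * Pᵀ = P * (D * Dᵀ) * Pᵀ := by rw [hDD]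
      _ = P * (D * (Q * Qᵀ) * Dᵀ) * Pᵀ := by rw [hQ1, Matrix.mul_one]
      _ = _ := by simp only [transpose_mul, Matrix.mul_assoc]
  have hdet : L.det ≠ 0 := by
    intro h
    have : Sg.det = 0 := by rw [hLL, det_mul, h, zero_mul]
    exact hSg.det_pos.ne' this
  have hlm0 : 0 ≤ lambdaM Sg hSg.1 := by
    apply le_min
    · exact Real.iInf_nonneg fun p => (mul_pos (hpos _) (hpos _)).le
    · exact Real.iInf_nonneg fun p => (hpos _).le
  have hlm1 : ∀ i, lambdaM Sg hSg.1 ≤ lam i := fun i =>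
    (min_le_right _ _).trans (ciInf_le (Set.finite_range _).bddBelow i)
  have hlm2 : ∀ i j, lambdaM Sg hSg.1 ≤ lam i * lam j := fun i j =>
    (min_le_left _ _).trans
      (ciInf_le (f := fun p : Fin d × Fin d => lam p.1 * lam p.2) (Set.finite_range _).bddBelow (i, j))
  refine ⟨L, fun i => -(1/2) * ev i, Lᵀ *ᵥ v, hdet, hLL, ?_, ?_⟩
  · intro y
    have e1 : (L *ᵥ y) ⬝ᵥ (U *ᵥ (L *ᵥ y)) = y ⬝ᵥ ((Lᵀ * U * L) *ᵥ y) := by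
      clear_value L
      rw [← mulVec_mulVec, ← mulVec_mulVec, dotProduct_mulVec y Lᵀ, vecMul_transpose]
    have e2 : v ⬝ᵥ (L *ᵥ y) = (Lᵀ *ᵥ v) ⬝ᵥ y := by
      rw [dotProduct_mulVec, mulVec_transpose]
    rw [e1, e2, hLU, quad, Finset.sum_add_distrib, dotProduct, Finset.mul_sum]
    congr 1
    apply Finset.sum_congr rfl
    intro i _
    rw [mulVec_diagonal]; ring
  · have hv : lambdaM Sg hSg.1 * vnorm v ^ 2 ≤ ∑ i, (Lᵀ *ᵥ v) i ^ 2 := by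
      have e : Lᵀ *ᵥ v = Qᵀ *ᵥ (D *ᵥ (Pᵀ *ᵥ v)) := by
        rw [mulVec_mulVec, mulVec_mulVec, hL]
        simp only [transpose_mul, hD, diagonal_transpose, Matrix.mul_assoc]
      rw [e, sumsq_vec Q hQ1, vnorm, Real.sq_sqrt (Finset.sum_nonneg fun i _ => sq_nonneg _),
        ← sumsq_vec P hP1 v, Finset.mul_sum]
      apply Finset.sum_le_sum
      intro i _
      rw [hD, mulVec_diagonal, mul_pow, Real.sq_sqrt (hpos i).le]
      exact mul_le_mul_of_nonneg_right (hlm1 i) (sq_nonneg _)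
    have hu : lambdaM Sg hSg.1 * fnorm U ^ 2 ≤ ∑ i, ev i ^ 2 := by
      have e : ∑ i, ev i ^ 2 = ∑ i, ∑ j, M i j ^ 2 := by
        rw [← sumsq_conj Q M hQ1, hQM']
        apply Finset.sum_congr rfl
        intro i _
        rw [Finset.sum_eq_single i]
        · simp
        · intro j _ hj; simp [diagonal_apply_ne' _ hj]
        · simp
      rw [e, fnorm, Real.sq_sqrt (by positivity),
        ← sumsq_conj P U hP1, Finset.mul_sum]
      apply Finset.sum_le_sum
      intro i _
      rw [Finset.mul_sum]
      apply Finset.sum_le_sum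
      intro j _
      rw [hM, hD, mul_diagonal, diagonal_mul, mul_pow, mul_pow, Real.sq_sqrt (hpos i).le,
        Real.sq_sqrt (hpos j).le]
      have := mul_le_mul_of_nonneg_right (hlm2 i j) (sq_nonneg ((Pᵀ * U * P) i j))
      linarith
    have e : 2 * qvar (fun i => -(1/2) * ev i) (Lᵀ *ᵥ v) = ∑ i, ev i ^ 2 + 2 * ∑ i, (Lᵀ *ᵥ v) i ^ 2 := by
      rw [qvar, Finset.mul_sum, Finset.mul_sum, ← Finset.sum_add_distrib]
      apply Finset.sum_congr rfl
      intro i _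
      ring
    have : 0 ≤ ∑ i, (Lᵀ *ᵥ v) i ^ 2 := Finset.sum_nonneg fun i _ => sq_nonneg _
    rw [e]
    linarith

/-- There is a universal constant `c > 0` such that: for symmetric positive
definite `Σ` and measurable `S ⊆ ℝ^d` with `N(0,Σ;S) ≥ β`, `β ∈ (0,1]`, for every symmetric
`U` and every `v`,
`Var_{z ∼ N(0,Σ,S)}[−(1/2)zᵀUz + vᵀz] ≥ c β⁴ λ_m(Σ) (‖U‖_F² + ‖v‖₂²)`;
i.e. the covariance quadratic form of `t(z) = ((−(1/2)zzᵀ)^♭, z)` under the truncated normal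
`N(0,Σ,S)`, on pairs `(U,v)` with `U` symmetric, is bounded below by `c β⁴ λ_m(Σ)` times the
identity. -/
theorem statement8 :
    ∃ c : ℝ, 0 < c ∧
      ∀ (d : ℕ), 1 ≤ d →
      ∀ (Sg : Matrix (Fin d) (Fin d) ℝ) (hSg : Sg.PosDef)
        (S : Set (Fin d → ℝ)), MeasurableSet S →
      ∀ β : ℝ, 0 < β → β ≤ 1 → ENNReal.ofReal β ≤ gauss 0 Sg S →
      ∀ (U : Matrix (Fin d) (Fin d) ℝ), U.IsSymm → ∀ v : Fin d → ℝ,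
        c * β ^ 4 * lambdaM Sg hSg.1 * (fnorm U ^ 2 + vnorm v ^ 2) ≤
          variance (fun z => -(1 / 2) * (z ⬝ᵥ (U *ᵥ z)) + v ⬝ᵥ z)
            (truncGauss 0 Sg S) := by
  set C : ℝ := Real.exp (1/2) * K0 + 1 with hC
  have hCpos : 0 < C := by have := K0_nonneg; positivity
  refine ⟨1 / (64 * C ^ 4), by positivity, ?_⟩
  intro d _ Sg hSg S hS β hβ _ hβS U hU v
  obtain ⟨L, a, b, hdet, hLL, hquad, hlam⟩ := reduction Sg hSg U hU v
  set f : (Fin d → ℝ) → ℝ := fun z => -(1 / 2) * (z ⬝ᵥ (U *ᵥ z)) + v ⬝ᵥ z with hf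
  have hmap : gauss 0 Sg = (gamn d).map (fun y => L *ᵥ y) := by
    conv_lhs => rw [hLL]
    exact gauss_eq_map L hdet
  have hfc : Continuous f := by rw [hf]; fun_prop
  have hLm : Measurable (fun y : Fin d → ℝ => L *ᵥ y) := by
    have : Continuous (fun y : Fin d → ℝ => L *ᵥ y) := by fun_prop
    exact this.measurable
  have hprob : IsProbabilityMeasure (gauss 0 Sg) := by
    rw [hmap]; exact Measure.isProbabilityMeasure_map hLm.aemeasurable
  have hS0 : gauss 0 Sg S ≠ 0 := by
    have : 0 < ENNReal.ofReal β := ENNReal.ofReal_pos.2 hβ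
    exact (this.trans_le hβS).ne'
  have hcp : IsProbabilityMeasure (truncGauss 0 Sg S) := cond_isProbabilityMeasure hS0
  have hmem0 : MemLp f 2 (gauss 0 Sg) := by
    rw [hmap, memLp_map_measure_iff hfc.aestronglyMeasurable hLm.aemeasurable]
    have : f ∘ (fun y => L *ᵥ y) = quad a b := by ext y; exact hquad y
    rw [this]; exact memLp_quad a b
  have hmem : MemLp f 2 (truncGauss 0 Sg S) := by
    unfold truncGauss ProbabilityTheory.cond
    exact (hmem0.restrict S).smul_measure (ENNReal.inv_ne_top.2 hS0)
  have hq0 : 0 ≤ qvar a b := Finset.sum_nonneg fun i _ => by positivity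
  set q := qvar a b with hq
  suffices hmain : q * β ^ 4 / (32 * C ^ 4) ≤ variance f (truncGauss 0 Sg S) by
    refine le_trans ?_ hmain
    calc 1 / (64 * C ^ 4) * β ^ 4 * lambdaM Sg hSg.1 * (fnorm U ^ 2 + vnorm v ^ 2)
        = 1 / (64 * C ^ 4) * β ^ 4 * (lambdaM Sg hSg.1 * (fnorm U ^ 2 + vnorm v ^ 2)) := by ring
      _ ≤ 1 / (64 * C ^ 4) * β ^ 4 * (2 * q) := by gcongr
      _ = _ := by field_simp; ring
  rcases hq0.eq_or_lt with h0 | hqpos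
  · rw [← h0]; simpa using variance_nonneg f _
  set ε : ℝ := √q * (β / (2 * C)) ^ 2 with hε
  have hεpos : 0 < ε := by positivity
  have hε2 : ε ^ 2 = q * (β / (2 * C)) ^ 4 := by
    rw [hε, mul_pow, Real.sq_sqrt hq0]; ring
  set m := ∫ z, f z ∂(truncGauss 0 Sg S) with hm
  have hcheb := meas_ge_le_variance_div_sq hmem hεpos
  rw [← hm] at hcheb
  have hA : MeasurableSet {z | |f z - m| < ε} :=
    measurableSet_lt (hfc.sub continuous_const).abs.measurable measurable_const
  have hsb : (gauss 0 Sg).real {z | |f z - m| < ε} ≤ β / 2 := by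
    rw [hmap, map_measureReal_apply hLm hA]
    have e : (fun y => L *ᵥ y) ⁻¹' {z | |f z - m| < ε} = {y | |quad a b y - m| < ε} := by
      ext y
      simp only [Set.mem_preimage, Set.mem_setOf_eq, hf, hquad]
    rw [e]
    refine (smallball a b hqpos m ε hεpos).trans ?_
    have e2 : (qvar a b / ε ^ 2) ^ (-(1/4) : ℝ) = β / (2 * C) := by
      have hx : 0 < β / (2 * C) := by positivity
      have : qvar a b / ε ^ 2 = (β / (2 * C)) ^ (-4 : ℝ) := by
        rw [hε2, ← hq, Real.rpow_neg hx.le]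
        norm_cast
        field_simp
      rw [this, ← Real.rpow_mul hx.le]
      norm_num
    rw [e2]
    calc Real.exp (1/2) * K0 * (β / (2 * C)) ≤ C * (β / (2 * C)) := by
          gcongr; rw [hC]; linarith
      _ = β / 2 := by field_simp
  have hhalf : (truncGauss 0 Sg S).real {z | |f z - m| < ε} ≤ 1 / 2 := by
    unfold truncGauss
    rw [measureReal_def, cond_apply hS, ENNReal.toReal_mul, ENNReal.toReal_inv, ← measureReal_def, ← measureReal_def]
    have hβr : β ≤ (gauss 0 Sg).real S := by
      rw [measureReal_def]
      exact (ENNReal.ofReal_le_iff_le_toReal (measure_ne_top _ _)).1 hβS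
    have h1 : (gauss 0 Sg).real (S ∩ {z | |f z - m| < ε}) ≤ β / 2 :=
      (measureReal_mono Set.inter_subset_right).trans hsb
    calc ((gauss 0 Sg).real S)⁻¹ * (gauss 0 Sg).real (S ∩ {z | |f z - m| < ε})
        ≤ β⁻¹ * (β / 2) := by gcongr
      _ = 1 / 2 := by field_simp
  have hge : 1 / 2 ≤ (truncGauss 0 Sg S).real {z | ε ≤ |f z - m|} := by
    have e : {z | ε ≤ |f z - m|} = {z | |f z - m| < ε}ᶜ := by
      ext z; simp
    rw [e, probReal_compl_eq_one_sub hA]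
    linarith
  have hfin : (truncGauss 0 Sg S).real {z | ε ≤ |f z - m|} ≤ variance f (truncGauss 0 Sg S) / ε ^ 2 := by
    rw [measureReal_def]
    exact ENNReal.toReal_le_of_le_ofReal (div_nonneg (variance_nonneg _ _) (by positivity)) hcheb
  have h2 := hge.trans hfin
  rw [le_div_iff₀ (by positivity), hε2] at h2
  refine le_trans (le_of_eq ?_) h2
  field_simp
  norm_num

end
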